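/- Let X be a topological space, let I denote the unit interval [0,1], and let D be a set of continuous maps I → X such that (a) every constant map lies in D, and (b) D is closed under concatenation: whenever p, q ∈ D with p(1) = q(0), the concatenated path (which follows p at double speed on [0, 1/2] and q at double speed on [1/2, 1]) lies in D. Then the following are equivalent: (1) D is closed under pre-composition with every continuous weakly monotone (order-preserving) map φ : I → I (i.e., p ∈ D implies p ∘ φ ∈ D for all such φ); (2) D is closed under pre-composition with every continuous weakly monotone map φ : I → I satisfying φ(0) = 0 and φ(1) = 1, and moreover D is closed under factorizations with respect to concatenation: whenever p and q are continuous maps I → X with p(1) = q(0) whose concatenation lies in D, both p and q lie in D. -/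

import Mathlib

open unitInterval

/-- The path underlying a continuous map `I → X`, from its value at `0` to its value
at `1`. -/
def ContinuousMap.toPathSelf {X : Type*} [TopologicalSpace X]
    (p : C(unitInterval, X)) : Path (p 0) (p 1) :=
  ⟨p, rfl, rfl⟩

/-- The concatenation of two continuous maps `p q : I → X` with `p 1 = q 0`: it follows
`p` at double speed on `[0, 1/2]` and `q` at double speed on `[1/2, 1]`. -/
noncomputable def DSpace.concat {X : Type*} [TopologicalSpace X]
    (p q : C(unitInterval, X)) (h : p 1 = q 0) : C(unitInterval, X) :=
  (p.toPathSelf.trans (q.toPathSelf.cast h rfl)).toContinuousMap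

namespace DSpace

theorem concat_apply {X : Type*} [TopologicalSpace X]
    (p q : C(unitInterval, X)) (h : p 1 = q 0) (t : unitInterval) :
    concat p q h t = if h : (t : ℝ) ≤ 1 / 2 then
      p ⟨2 * t, (unitInterval.mul_pos_mem_iff zero_lt_two).2 ⟨t.2.1, h⟩⟩ else
      q ⟨2 * t - 1, unitInterval.two_mul_sub_one_mem_iff.2 ⟨(not_le.1 h).le, t.2.2⟩⟩ :=
  Path.trans_apply _ _ t

theorem concat_zero {X : Type*} [TopologicalSpace X]
    (p q : C(unitInterval, X)) (h : p 1 = q 0) : concat p q h 0 = p 0 :=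
  Path.source _

theorem concat_one {X : Type*} [TopologicalSpace X]
    (p q : C(unitInterval, X)) (h : p 1 = q 0) : concat p q h 1 = q 1 :=
  Path.target _

theorem comp_concat {X Y : Type*} [TopologicalSpace X] [TopologicalSpace Y] (f : C(X, Y))
    (p q : C(unitInterval, X)) (h : p 1 = q 0) :
    f.comp (concat p q h) = concat (f.comp p) (f.comp q) (congrArg f h) := by
  ext t
  simp only [ContinuousMap.comp_apply, concat_apply]
  split_ifs <;> rfl

theorem concat_monotone (p q : C(unitInterval, unitInterval)) (h : p 1 = q 0)
    (hp : Monotone p) (hq : Monotone q) : Monotone (concat p q h) := by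
  intro s t hst
  have hst' : (s : ℝ) ≤ t := hst
  rw [concat_apply, concat_apply]
  split_ifs with h1 h2 h2
  · exact hp (Subtype.mk_le_mk.2 (by linarith))
  · exact (hp unitInterval.le_one').trans (h.le.trans (hq unitInterval.nonneg'))
  · exact absurd (hst'.trans h2) h1
  · exact hq (Subtype.mk_le_mk.2 (by linarith))

/-- The first half `t ↦ t / 2`. -/
noncomputable def firstHalf : C(unitInterval, unitInterval) :=
  ⟨fun t => ⟨(t : ℝ) / 2, by have := t.2.1; have := t.2.2; constructor <;> linarith⟩,
    by fun_prop⟩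

/-- The second half `t ↦ (1 + t) / 2`. -/
noncomputable def secondHalf : C(unitInterval, unitInterval) :=
  ⟨fun t => ⟨(1 + (t : ℝ)) / 2, by have := t.2.1; have := t.2.2; constructor <;> linarith⟩,
    by fun_prop⟩

theorem concat_firstHalf {X : Type*} [TopologicalSpace X]
    (p q : C(unitInterval, X)) (h : p 1 = q 0) : (concat p q h).comp firstHalf = p := by
  ext t
  have h2 : (firstHalf t : ℝ) ≤ 1 / 2 := by
    have := t.2.2
    change (t : ℝ) / 2 ≤ 1 / 2
    linarith
  rw [ContinuousMap.comp_apply, concat_apply, dif_pos h2]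
  congr 1
  ext
  simp only [firstHalf, ContinuousMap.coe_mk]
  ring

theorem concat_secondHalf {X : Type*} [TopologicalSpace X]
    (p q : C(unitInterval, X)) (h : p 1 = q 0) : (concat p q h).comp secondHalf = q := by
  ext t
  rw [ContinuousMap.comp_apply, concat_apply]
  split_ifs with h2
  · have h3 : (1 + (t : ℝ)) / 2 ≤ 1 / 2 := h2
    have h0 : t = 0 := by
      ext
      have := t.2.1
      simp only [Set.Icc.coe_zero]
      linarith
    subst h0
    rw [← h]
    congr 1
    ext
    simp [secondHalf]
  · congr 1
    ext
    simp only [secondHalf, ContinuousMap.coe_mk]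
    ring

end DSpace

/-- For a set `D` of continuous paths in `X` containing all constant paths and closed
under concatenation, closure under pre-composition with all continuous weakly monotone
maps `I → I` is equivalent to closure under pre-composition with continuous weakly
monotone endpoint-preserving maps `I → I` together with closure under factorizations with
respect to concatenation. -/
theorem dspace_reparametrization_iff {X : Type*} [TopologicalSpace X]
    (D : Set C(unitInterval, X))
    (hconst : ∀ x : X, (ContinuousMap.const unitInterval x) ∈ D)
    (hconcat : ∀ (p q : C(unitInterval, X)) (h : p 1 = q 0),
      p ∈ D → q ∈ D → DSpace.concat p q h ∈ D) :
    (∀ φ : C(unitInterval, unitInterval), Monotone ⇑φ →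
        ∀ p ∈ D, p.comp φ ∈ D) ↔
      ((∀ φ : C(unitInterval, unitInterval), Monotone ⇑φ → φ 0 = 0 → φ 1 = 1 →
          ∀ p ∈ D, p.comp φ ∈ D) ∧
        (∀ (p q : C(unitInterval, X)) (h : p 1 = q 0),
          DSpace.concat p q h ∈ D → p ∈ D ∧ q ∈ D)) := by
  constructor
  · intro H
    refine ⟨fun φ hφ _ _ => H φ hφ, fun p q h hD => ⟨?_, ?_⟩⟩
    · rw [← DSpace.concat_firstHalf p q h]
      refine H _ ?_ _ hD
      intro s t hst
      have hst' : (s : ℝ) ≤ t := hst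
      exact Subtype.mk_le_mk.2 (by linarith)
    · rw [← DSpace.concat_secondHalf p q h]
      refine H _ ?_ _ hD
      intro s t hst
      have hst' : (s : ℝ) ≤ t := hst
      exact Subtype.mk_le_mk.2 (by linarith)
  · rintro ⟨H, F⟩ φ hφ p hp
    let a : C(unitInterval, unitInterval) := ⟨fun t => t * φ 0, by fun_prop⟩
    let b : C(unitInterval, unitInterval) := ⟨fun t => σ (σ t * σ (φ 1)), by fun_prop⟩
    have ha : Monotone a := by
      intro s t hst
      have hst' : (s : ℝ) ≤ t := hst
      exact Subtype.coe_le_coe.1 (mul_le_mul_of_nonneg_right hst' (φ 0).2.1)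
    have hb : Monotone b := by
      intro s t hst
      have hst' : (s : ℝ) ≤ t := hst
      have h1 : (1 - (t : ℝ)) * (1 - φ 1) ≤ (1 - s) * (1 - φ 1) :=
        mul_le_mul_of_nonneg_right (by linarith) (by have := (φ 1).2.2; linarith)
      refine Subtype.coe_le_coe.1 ?_
      change 1 - (1 - (s : ℝ)) * (1 - φ 1) ≤ 1 - (1 - (t : ℝ)) * (1 - φ 1)
      linarith
    have h1 : a 1 = φ 0 := by simp [a]
    have h2 : DSpace.concat a φ h1 1 = b 0 := by
      rw [DSpace.concat_one]
      simp [b]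
    have key := H (DSpace.concat (DSpace.concat a φ h1) b h2)
      (DSpace.concat_monotone _ _ _ (DSpace.concat_monotone _ _ _ ha hφ) hb)
      (by rw [DSpace.concat_zero, DSpace.concat_zero]; simp [a])
      (by rw [DSpace.concat_one]; simp [b]) p hp
    rw [DSpace.comp_concat] at key
    have key2 := (F _ _ _ key).1
    rw [DSpace.comp_concat] at key2
    exact (F _ _ _ key2).2
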